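/- For every multi-index ν and every unit multi-index e (i.e. |e| = 1), the double sum over multi-indices η with 0 < η ≤ ν and multi-indices ℓ with 0 < ℓ < η of (ν choose η) · (η choose ℓ) · [1/2]_{|η−ℓ|} · [1/2]_{|ℓ|} · [1/2]_{|ν+e−η|} is at most 2 · [1/2]_{|ν+e|}. -/

import Mathlib

/-- The absolute falling factorial `[1/2]_n`: `[1/2]_0 = 1`, and
`[1/2]_{n+1} = |n - 1/2| * [1/2]_n`, so that `[1/2]_1 = 1/2`. -/
noncomputable def gd : ℕ → ℝ
  | 0 => 1
  | n + 1 => |(n : ℝ) - 1 / 2| * gd n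

/-- The total degree `|ν| = Σ_j ν_j` of a multi-index. -/
def deg (ν : ℕ →₀ ℕ) : ℕ := ν.sum fun _ n => n

/-- The multi-index binomial coefficient `(ν choose η) = Π_j (ν_j choose η_j)`. -/
def mchoose (ν η : ℕ →₀ ℕ) : ℕ := ∏ j ∈ ν.support ∪ η.support, (ν j).choose (η j)

open Finset PowerSeries in
theorem aux_vand_filter (ν : ℕ →₀ ℕ) :
    ∑ η ∈ Finset.Icc 0 ν, (mchoose ν η : Polynomial ℝ) * Polynomial.X ^ (deg η) =
      (1 + Polynomial.X) ^ (deg ν) := by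
  have h1 : ((1 : Polynomial ℝ) + Polynomial.X) ^ (deg ν) =
      ∏ j ∈ ν.support,
        ∑ i ∈ Finset.Icc 0 (ν j), ((ν j).choose i : Polynomial ℝ) * Polynomial.X ^ i := by
    rw [deg, Finsupp.sum, ← Finset.prod_pow_eq_pow_sum]
    refine Finset.prod_congr rfl fun j _ => ?_
    rw [add_comm, add_pow, ← Nat.range_succ_eq_Icc_zero]
    refine Finset.sum_congr rfl fun i _ => ?_
    simp [mul_comm]
  rw [h1, Finset.prod_sum]
  have h2 : Finset.Icc 0 ν = ν.support.finsupp
      (fun j => Finset.Icc 0 (ν j)) := by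
    ext f
    rw [Finset.mem_finsupp_iff, Finset.mem_Icc]
    constructor
    · rintro ⟨_, h⟩
      refine ⟨?_, fun i _ => by simpa using h i⟩
      simpa using Finsupp.support_mono h
    · rintro ⟨h, h'⟩
      refine ⟨zero_le, fun i => ?_⟩
      by_cases hi : i ∈ ν.support
      · simpa using h' i (by simpa using hi)
      · have : i ∉ f.support := fun h3 => hi (by simpa using h h3)
        simp at this
        simp [this]
  rw [h2, Finset.finsupp, Finset.sum_map]
  refine Finset.sum_congr (by congr!) fun p hp => ?_
  have hsub : (Finsupp.indicator ν.support p).support ⊆ ν.support := by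
    simpa using Finsupp.support_indicator_subset ν.support p
  rw [Finset.prod_mul_distrib]
  simp only [Function.Embedding.coeFn_mk]
  congr 1
  · rw [mchoose, Finset.union_eq_left.2 hsub]
    push_cast
    rw [← Finset.prod_attach]
    refine Finset.prod_congr rfl fun x _ => ?_
    rw [Finsupp.indicator_of_mem x.2]
  · rw [deg, Finsupp.sum_of_support_subset _ hsub _ (by simp), Finset.prod_pow_eq_pow_sum,
      ← Finset.sum_attach]
    congr 1
    refine Finset.sum_congr rfl fun x _ => ?_
    rw [Finsupp.indicator_of_mem x.2]

theorem aux_deg_add (a b : ℕ →₀ ℕ) : deg (a + b) = deg a + deg b := by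
  unfold deg
  exact Finsupp.sum_add_index' (by simp) (by simp)

theorem aux_deg_sub {a b : ℕ →₀ ℕ} (h : b ≤ a) : deg (a - b) = deg a - deg b := by
  have := aux_deg_add (a - b) b
  rw [tsub_add_cancel_of_le h] at this
  omega

theorem aux_deg_zero (a : ℕ →₀ ℕ) : deg a = 0 ↔ a = 0 := by
  unfold deg Finsupp.sum
  rw [Finset.sum_eq_zero_iff]
  constructor
  · intro h
    ext i
    by_contra hi
    exact hi (h i (by simpa using hi))
  · rintro rfl
    simp

theorem aux_deg_mono {a b : ℕ →₀ ℕ} (h : b ≤ a) : deg b ≤ deg a := by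
  have := aux_deg_add (a - b) b
  rw [tsub_add_cancel_of_le h] at this
  omega

theorem aux_deg_eq {a b : ℕ →₀ ℕ} (h : b ≤ a) (hd : deg b = deg a) : b = a := by
  have := aux_deg_sub h
  rw [hd, Nat.sub_self, aux_deg_zero] at this
  exact le_antisymm h (tsub_eq_zero_iff_le.1 this)

theorem aux_vand (ν : ℕ →₀ ℕ) (F : ℕ → ℝ) :
    ∑ η ∈ Finset.Icc 0 ν, (mchoose ν η : ℝ) * F (deg η) =
      ∑ k ∈ Finset.range (deg ν + 1), ((deg ν).choose k : ℝ) * F k := by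
  have hm : ∀ η ∈ Finset.Icc 0 ν, deg η ∈ Finset.range (deg ν + 1) := by
    intro η hη
    have := aux_deg_mono (Finset.mem_Icc.1 hη).2
    simp; omega
  rw [← Finset.sum_fiberwise_of_maps_to hm]
  refine Finset.sum_congr rfl fun k _ => ?_
  have := congrArg (fun p => Polynomial.coeff p k) (aux_vand_filter ν)
  simp only [Polynomial.finsetSum_coeff, Polynomial.coeff_one_add_X_pow] at this
  rw [← this, Finset.sum_mul, Finset.sum_filter]
  refine Finset.sum_congr rfl fun η _ => ?_
  rw [← Polynomial.C_eq_natCast, Polynomial.coeff_C_mul, Polynomial.coeff_X_pow]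
  by_cases h : deg η = k
  · simp [h]
  · simp [h, Ne.symm h]

/-- `gd` with the value at `0` removed. -/
noncomputable def auxh (n : ℕ) : ℝ := if n = 0 then 0 else gd n

theorem aux_gd_nonneg (n : ℕ) : 0 ≤ gd n := by
  induction n with
  | zero => simp [gd]
  | succ n ih => rw [gd]; positivity

theorem auxh_nonneg (n : ℕ) : 0 ≤ auxh n := by
  unfold auxh
  split_ifs
  · exact le_rfl
  · exact aux_gd_nonneg n

theorem auxh_rec (n : ℕ) : auxh (n + 1) = ((n : ℝ) - 1 / 2) * auxh n + if n = 0 then 1 / 2 else 0 := by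
  rcases n with _ | n
  · simp [auxh, gd]
  · simp only [auxh, Nat.add_eq_zero_iff, one_ne_zero, and_false, if_false, add_zero]
    rw [gd, abs_of_nonneg]
    push_cast
    have : (0 : ℝ) ≤ n := by positivity
    linarith

/-- Exponential generating function of `auxh`. -/
noncomputable def auxU : PowerSeries ℝ := PowerSeries.mk fun n => auxh n / (n.factorial : ℝ)

theorem auxU_deriv_coeff (n : ℕ) :
    PowerSeries.coeff n (PowerSeries.derivative ℝ auxU) = auxh (n + 1) / (n.factorial : ℝ) := by
  rw [PowerSeries.coeff_derivative, auxU, PowerSeries.coeff_mk, Nat.factorial_succ]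
  push_cast
  field_simp

theorem auxU_ode : 2 * ((1 - PowerSeries.X) * PowerSeries.derivative ℝ auxU) = 1 - auxU := by
  have h2 : (2 : PowerSeries ℝ) = PowerSeries.C 2 := (map_ofNat PowerSeries.C 2).symm
  ext n
  rw [h2, PowerSeries.coeff_C_mul, sub_mul, one_mul, map_sub, map_sub, auxU_deriv_coeff]
  rcases n with _ | n
  · simp [auxU, auxh, gd]
  · rw [PowerSeries.coeff_succ_X_mul, auxU_deriv_coeff, auxU, PowerSeries.coeff_mk,
      auxh_rec (n + 1), PowerSeries.coeff_one, Nat.factorial_succ]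
    simp only [Nat.add_eq_zero_iff, one_ne_zero, and_false, if_false]
    push_cast
    field_simp
    ring

theorem auxU_sq : auxU * auxU = 2 * auxU - PowerSeries.X := by
  set V : PowerSeries ℝ := (1 - auxU) * (1 - auxU) with hV
  have hode : (1 - PowerSeries.X) * PowerSeries.derivative ℝ V = - V := by
    have : PowerSeries.derivative ℝ V = -2 * (1 - auxU) * PowerSeries.derivative ℝ auxU := by
      rw [hV, Derivation.leibniz]
      simp only [map_sub, Derivation.map_one_eq_zero, smul_eq_mul]
      ring
    rw [this, hV]
    linear_combination (-(1 - auxU)) * auxU_ode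
  have hc : ∀ n : ℕ, PowerSeries.coeff (n + 1) V * ((n : ℝ) + 1) =
      ((n : ℝ) - 1) * PowerSeries.coeff n V := by
    intro n
    have := congrArg (PowerSeries.coeff n) hode
    rw [sub_mul, one_mul, map_sub, map_neg, PowerSeries.coeff_derivative] at this
    rcases n with _ | n
    · simp at this ⊢
      linarith
    · rw [PowerSeries.coeff_succ_X_mul, PowerSeries.coeff_derivative] at this
      push_cast at this ⊢
      linarith
  have h0 : PowerSeries.coeff 0 V = 1 := by
    simp [hV, auxU, auxh]
  have h1 : PowerSeries.coeff 1 V = -1 := by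
    have := hc 0
    rw [h0] at this
    simpa using this
  have h2 : ∀ n : ℕ, PowerSeries.coeff (n + 2) V = 0 := by
    intro n
    induction n with
    | zero =>
      have := hc 1
      norm_num at this
      simpa using this
    | succ n ih =>
      have := hc (n + 2)
      rw [ih, mul_zero] at this
      refine (mul_eq_zero.1 this).resolve_right ?_
      positivity
  have hVX : V = 1 - PowerSeries.X := by
    ext n
    rcases n with _ | _ | n
    · rw [h0]; simp
    · rw [h1]; simp [PowerSeries.coeff_one]
    · rw [h2]; simp [PowerSeries.coeff_one, PowerSeries.coeff_X]
  rw [hV] at hVX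
  linear_combination hVX

theorem auxS (n : ℕ) :
    ∑ k ∈ Finset.range (n + 1), (n.choose k : ℝ) * (auxh (n - k) * auxh k) ≤ 2 * auxh n := by
  have h2 : (2 : PowerSeries ℝ) = PowerSeries.C 2 := (map_ofNat PowerSeries.C 2).symm
  have := congrArg (PowerSeries.coeff n) auxU_sq
  rw [h2, map_sub, PowerSeries.coeff_C_mul, PowerSeries.coeff_mul,
    Finset.Nat.sum_antidiagonal_eq_sum_range_succ_mk, PowerSeries.coeff_X] at this
  simp only [auxU, PowerSeries.coeff_mk] at this
  have e : ∑ k ∈ Finset.range (n + 1), (n.choose k : ℝ) * (auxh (n - k) * auxh k) =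
      n.factorial * ∑ k ∈ Finset.range (n + 1),
        auxh k / (k.factorial : ℝ) * (auxh (n - k) / ((n - k).factorial : ℝ)) := by
    rw [Finset.mul_sum]
    refine Finset.sum_congr rfl fun k hk => ?_
    rw [Nat.cast_choose ℝ (by simpa [Nat.lt_succ_iff] using hk)]
    field_simp
  rw [e, this, mul_sub]
  have h3 : (n.factorial : ℝ) * (2 * (auxh n / n.factorial)) = 2 * auxh n := by
    field_simp
  rw [h3]
  have : (0 : ℝ) ≤ n.factorial * (if n = 1 then 1 else 0) := by positivity
  linarith

theorem auxT (n : ℕ) :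
    ∑ k ∈ Finset.range (n + 1), (n.choose k : ℝ) * (auxh k * auxh (n + 1 - k)) ≤ auxh (n + 1) := by
  have h2 : (2 : PowerSeries ℝ) = PowerSeries.C 2 := (map_ofNat PowerSeries.C 2).symm
  have hd : 2 * (auxU * PowerSeries.derivative ℝ auxU) =
      2 * PowerSeries.derivative ℝ auxU - 1 := by
    have := congrArg (PowerSeries.derivative ℝ) auxU_sq
    rw [Derivation.leibniz, map_sub, Derivation.leibniz, h2, PowerSeries.derivative_C,
      PowerSeries.derivative_X, ← h2] at this
    simp only [smul_eq_mul] at this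
    linear_combination this
  have := congrArg (PowerSeries.coeff n) hd
  rw [h2, map_sub, PowerSeries.coeff_C_mul, PowerSeries.coeff_C_mul, PowerSeries.coeff_mul,
    Finset.Nat.sum_antidiagonal_eq_sum_range_succ_mk, PowerSeries.coeff_one] at this
  simp only [auxU_deriv_coeff] at this
  simp only [auxU, PowerSeries.coeff_mk] at this
  have e : ∑ k ∈ Finset.range (n + 1), (n.choose k : ℝ) * (auxh k * auxh (n + 1 - k)) =
      n.factorial * ∑ k ∈ Finset.range (n + 1),
        auxh k / (k.factorial : ℝ) * (auxh (n - k + 1) / ((n - k).factorial : ℝ)) := by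
    rw [Finset.mul_sum]
    refine Finset.sum_congr rfl fun k hk => ?_
    have hk' : k ≤ n := by simpa [Nat.lt_succ_iff] using hk
    rw [Nat.cast_choose ℝ hk', show n + 1 - k = n - k + 1 by omega]
    field_simp
  rw [e]
  have h3 : (n.factorial : ℝ) * (auxh (n + 1) / n.factorial) = auxh (n + 1) := by
    field_simp
  rw [← h3]
  refine mul_le_mul_of_nonneg_left ?_ (by positivity)
  have : (0 : ℝ) ≤ (if n = 0 then 1 else 0) := by positivity
  linarith

theorem aux_inner (η : ℕ →₀ ℕ) :
    ∑ l ∈ Finset.Ioo 0 η, (mchoose η l : ℝ) * (gd (deg (η - l)) * gd (deg l)) ≤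
      2 * auxh (deg η) := by
  refine le_trans ?_ (auxS (deg η))
  rw [← aux_vand η (fun k => auxh (deg η - k) * auxh k)]
  refine le_trans (le_of_eq ?_) (Finset.sum_le_sum_of_subset_of_nonneg
    (Finset.Ioo_subset_Icc_self) fun i _ _ =>
      mul_nonneg (Nat.cast_nonneg _) (mul_nonneg (auxh_nonneg _) (auxh_nonneg _)))
  refine Finset.sum_congr rfl fun l hl => ?_
  obtain ⟨h0, h1⟩ := Finset.mem_Ioo.1 hl
  rw [aux_deg_sub h1.le]
  have a : deg l ≠ 0 := fun h => h0.ne' ((aux_deg_zero l).1 h)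
  have b : deg η - deg l ≠ 0 := by
    have := aux_deg_mono h1.le
    have : deg l ≠ deg η := fun h => h1.ne (aux_deg_eq h1.le h)
    omega
  simp [auxh, a, b]

theorem stmt6 (ν e : ℕ →₀ ℕ) (he : deg e = 1) :
    ∑ η ∈ Finset.Ioc 0 ν, ∑ l ∈ Finset.Ioo 0 η,
        (mchoose ν η : ℝ) * (mchoose η l : ℝ) * gd (deg (η - l)) * gd (deg l) *
          gd (deg (ν + e - η))
      ≤ 2 * gd (deg (ν + e)) := by
  have hn : deg (ν + e) = deg ν + 1 := by rw [aux_deg_add, he]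
  have hg : gd (deg ν + 1) = auxh (deg ν + 1) := by simp [auxh]
  rw [hn, hg]
  refine le_trans ?_ (mul_le_mul_of_nonneg_left (auxT (deg ν)) (by norm_num))
  rw [← aux_vand ν (fun k => auxh k * auxh (deg ν + 1 - k)), Finset.mul_sum]
  refine le_trans (Finset.sum_le_sum fun η hη => ?_) (Finset.sum_le_sum_of_subset_of_nonneg
    (Finset.Ioc_subset_Icc_self) fun i _ _ => mul_nonneg (by norm_num)
      (mul_nonneg (Nat.cast_nonneg _) (mul_nonneg (auxh_nonneg _) (auxh_nonneg _))))
  obtain ⟨h0, h1⟩ := Finset.mem_Ioc.1 hη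
  have h2 : deg (ν + e - η) = deg ν + 1 - deg η := by
    rw [aux_deg_sub (h1.trans le_self_add), hn]
  have h3 : gd (deg (ν + e - η)) = auxh (deg ν + 1 - deg η) := by
    have := aux_deg_mono h1
    have : deg ν + 1 - deg η ≠ 0 := by omega
    rw [h2]
    simp [auxh, this]
  rw [h3]
  have h4 := mul_le_mul_of_nonneg_left (aux_inner η)
    (mul_nonneg (Nat.cast_nonneg (α := ℝ) (mchoose ν η)) (auxh_nonneg (deg ν + 1 - deg η)))
  rw [Finset.mul_sum] at h4
  calc _ = _ := Finset.sum_congr rfl fun l _ => by ring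
    _ ≤ _ := h4
    _ = _ := by ring
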